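/- arXiv:1712.01330 — 2 statements merged into one kernel-verified Lean document; each statement's English description precedes it below -/
import Mathlib

section
/- Let n ≥ 1 and 1 ≤ r ≤ 2n be integers, let A be a uniformly random r-element subset of the 2n-element set [n] × {0,1}, and let Y = |{j ∈ [n] : (j,0) ∈ A and (j,1) ∈ A}| be the number of complete pairs contained in A. Then for every integer t ≥ 1, Pr[Y ≥ t] ≤ exp(−t · ln(4nt/(e·r²))). -/
/-- The number of complete pairs `{(j,0),(j,1)}` contained in a subset `A` of `[n] × {0,1}`. -/
def pairCount (n : ℕ) (A : Finset (Fin n × Bool)) : ℕ :=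
  (Finset.univ.filter (fun j : Fin n => (j, false) ∈ A ∧ (j, true) ∈ A)).card

theorem aux_choose (N r s : ℕ) (hs : s ≤ r) (hr : r ≤ N) :
    (N - s).choose (r - s) * N ^ s ≤ N.choose r * r ^ s := by
  induction s with
  | zero => simp
  | succ s ih =>
    have ih := ih (by omega)
    obtain ⟨k, rfl⟩ : ∃ k, r = s + 1 + k := ⟨r - (s + 1), by omega⟩
    obtain ⟨m, rfl⟩ : ∃ m, N = s + 1 + k + m := ⟨N - (s + 1 + k), by omega⟩
    have e1 : s + 1 + k + m - (s + 1) = k + m := by omega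
    have e2 : s + 1 + k - (s + 1) = k := by omega
    have e3 : s + 1 + k + m - s = k + m + 1 := by omega
    have e4 : s + 1 + k - s = k + 1 := by omega
    rw [e1, e2]
    rw [e3, e4] at ih
    have h := Nat.add_one_mul_choose_eq (k + m) k
    refine Nat.le_of_mul_le_mul_left (c := k + m + 1) ?_ (by omega)
    calc (k + m + 1) * ((k + m).choose k * (s + 1 + k + m) ^ (s + 1))
        = ((k + m + 1) * (k + m).choose k) * (s + 1 + k + m) ^ (s + 1) := by ring
      _ = ((k + m + 1).choose (k + 1) * (s + 1 + k + m) ^ s) * ((k + 1) * (s + 1 + k + m)) := by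
          rw [h]; ring
      _ ≤ ((s + 1 + k + m).choose (s + 1 + k) * (s + 1 + k) ^ s) *
            ((k + m + 1) * (s + 1 + k)) := by
          apply Nat.mul_le_mul ih
          nlinarith [Nat.zero_le (s * m)]
      _ = _ := by ring

theorem aux_super {α : Type*} [Fintype α] [DecidableEq α] (r : ℕ) (S : Finset α) :
    (((Finset.univ : Finset α).powersetCard r).filter (fun A => S ⊆ A)).card ≤
      (Fintype.card α - S.card).choose (r - S.card) := by
  have : (Fintype.card α - S.card).choose (r - S.card) =
      ((Finset.univ \ S).powersetCard (r - S.card)).card := by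
    rw [Finset.card_powersetCard, Finset.card_sdiff_of_subset (Finset.subset_univ _),
      Finset.card_univ]
  rw [this]
  refine Finset.card_le_card_of_injOn (fun A => A \ S) ?_ ?_
  · intro A hA
    simp only [Finset.coe_filter, Finset.mem_powersetCard, Set.mem_ofPred_eq] at hA
    simp only [Finset.mem_coe, Finset.mem_powersetCard]
    refine ⟨Finset.sdiff_subset_sdiff (Finset.subset_univ _) (le_refl _), ?_⟩
    rw [Finset.card_sdiff_of_subset hA.2, hA.1.2]
  · intro A hA B hB h
    simp only [Finset.coe_filter, Finset.mem_powersetCard, Set.mem_ofPred_eq] at hA hB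
    have h' : A \ S = B \ S := h
    rw [← Finset.sdiff_union_of_subset hA.2, h', Finset.sdiff_union_of_subset hB.2]

theorem aux_count (n r t : ℕ) :
    (((Finset.univ : Finset (Fin n × Bool)).powersetCard r).filter
          (fun A => t ≤ pairCount n A)).card ≤
      n.choose t * (2 * n - 2 * t).choose (r - 2 * t) := by
  have hsub : ((Finset.univ : Finset (Fin n × Bool)).powersetCard r).filter
          (fun A => t ≤ pairCount n A) ⊆
      ((Finset.univ : Finset (Fin n)).powersetCard t).biUnion (fun T =>
        ((Finset.univ : Finset (Fin n × Bool)).powersetCard r).filter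
          (fun A => T ×ˢ (Finset.univ : Finset Bool) ⊆ A)) := by
    intro A hA
    rw [Finset.mem_filter] at hA
    obtain ⟨T, hT, hc⟩ := Finset.exists_subset_card_eq hA.2
    rw [Finset.mem_biUnion]
    refine ⟨T, Finset.mem_powersetCard.2 ⟨Finset.subset_univ _, hc⟩,
      Finset.mem_filter.2 ⟨hA.1, ?_⟩⟩
    rintro ⟨j, b⟩ hj
    have hj' := Finset.mem_filter.1 (hT (Finset.mem_product.1 hj).1)
    cases b
    · exact hj'.2.1
    · exact hj'.2.2
  refine (Finset.card_le_card hsub).trans ?_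
  have := Finset.card_biUnion_le_card_mul ((Finset.univ : Finset (Fin n)).powersetCard t)
    (fun T => ((Finset.univ : Finset (Fin n × Bool)).powersetCard r).filter
          (fun A => T ×ˢ (Finset.univ : Finset Bool) ⊆ A))
    ((2 * n - 2 * t).choose (r - 2 * t)) ?_
  · simpa using this
  · intro T hT
    have hc := (Finset.mem_powersetCard.1 hT).2
    have h := aux_super r (T ×ˢ (Finset.univ : Finset Bool))
    simpa [hc, mul_comm] using h

theorem aux_zero (n r t : ℕ) (h : r < 2 * t) :
    (((Finset.univ : Finset (Fin n × Bool)).powersetCard r).filter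
          (fun A => t ≤ pairCount n A)).card = 0 := by
  rw [Finset.card_eq_zero, Finset.filter_eq_empty_iff]
  intro A hA hle
  have hr := (Finset.mem_powersetCard.1 hA).2
  have hs : (Finset.univ.filter (fun j : Fin n => (j, false) ∈ A ∧ (j, true) ∈ A)) ×ˢ
      (Finset.univ : Finset Bool) ⊆ A := by
    rintro ⟨j, b⟩ hj
    have hj' := Finset.mem_filter.1 (Finset.mem_product.1 hj).1
    cases b
    · exact hj'.2.1
    · exact hj'.2.2
  have := Finset.card_le_card hs
  rw [Finset.card_product] at this
  unfold pairCount at hle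
  simp only [Finset.card_univ, Fintype.card_bool] at this
  omega

/-- For a uniformly random `r`-element subset `A` of `[n] × {0,1}`, and `Y` the number of
complete pairs in `A`, we have `Pr[Y ≥ t] ≤ exp(−t · ln(4nt/(e·r²)))` for every `t ≥ 1`. -/
theorem stmt_0 (n r t : ℕ) (hn : 1 ≤ n) (hr1 : 1 ≤ r) (hr2 : r ≤ 2 * n) (ht : 1 ≤ t) :
    ((((Finset.univ : Finset (Fin n × Bool)).powersetCard r).filter
          (fun A => t ≤ pairCount n A)).card : ℝ) /
        (((Finset.univ : Finset (Fin n × Bool)).powersetCard r).card : ℝ) ≤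
      Real.exp (-(t : ℝ) * Real.log (4 * n * t / (Real.exp 1 * r ^ 2))) := by
  rcases lt_or_ge r (2 * t) with h | h
  · rw [aux_zero n r t h]
    simp only [Nat.cast_zero, zero_div]
    exact (Real.exp_pos _).le
  have hn0 : (0 : ℝ) < n := by exact_mod_cast hn
  have hr0 : (0 : ℝ) < r := by exact_mod_cast hr1
  have ht0 : (0 : ℝ) < t := by exact_mod_cast ht
  have he := Real.exp_pos 1
  have hx : (0 : ℝ) < 4 * n * t / (Real.exp 1 * r ^ 2) := by positivity
  have hR : Real.exp (-(t : ℝ) * Real.log (4 * n * t / (Real.exp 1 * r ^ 2))) =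
      ((Real.exp 1 * r ^ 2) / (4 * n * t)) ^ t := by
    rw [neg_mul, ← mul_neg, ← Real.log_inv, Real.exp_nat_mul, Real.exp_log (inv_pos.2 hx),
      inv_div]
  rw [hR]
  have hcard : ((Finset.univ : Finset (Fin n × Bool)).powersetCard r).card
      = (2 * n).choose r := by
    simp [mul_comm]
  rw [hcard]
  have hC : (0 : ℝ) < (2 * n).choose r := by exact_mod_cast Nat.choose_pos hr2
  rw [div_le_iff₀ hC]
  have h1 : ((((Finset.univ : Finset (Fin n × Bool)).powersetCard r).filter
          (fun A => t ≤ pairCount n A)).card : ℝ) ≤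
      (n.choose t : ℝ) * ((2 * n - 2 * t).choose (r - 2 * t) : ℕ) := by
    exact_mod_cast aux_count n r t
  have h2 : (((2 * n - 2 * t).choose (r - 2 * t) : ℕ) : ℝ) * (2 * n) ^ (2 * t) ≤
      ((2 * n).choose r : ℕ) * (r : ℝ) ^ (2 * t) := by
    exact_mod_cast aux_choose (2 * n) r (2 * t) h hr2
  have h3 : (n.choose t : ℝ) ≤ (n : ℝ) ^ t / (t.factorial : ℝ) := Nat.choose_le_pow_div t n
  have h4 : (t : ℝ) ^ t / (t.factorial : ℝ) ≤ Real.exp t :=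
    Real.pow_div_factorial_le_exp (t : ℝ) ht0.le t
  have h5 : (n.choose t : ℝ) ≤ (Real.exp 1 * n / t) ^ t := by
    refine h3.trans ?_
    rw [div_pow, mul_pow, ← Real.exp_nat_mul, mul_one, le_div_iff₀ (by positivity)]
    calc (n : ℝ) ^ t / (t.factorial : ℝ) * (t : ℝ) ^ t
        = ((t : ℝ) ^ t / (t.factorial : ℝ)) * (n : ℝ) ^ t := by ring
      _ ≤ _ := by gcongr
  have h6 : (((2 * n - 2 * t).choose (r - 2 * t) : ℕ) : ℝ) ≤
      ((2 * n).choose r : ℕ) * ((r : ℝ) ^ 2 / (2 * n) ^ 2) ^ t := by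
    rw [div_pow, ← pow_mul, ← pow_mul, ← mul_div_assoc, le_div_iff₀ (by positivity)]
    exact h2
  calc _ ≤ _ := h1
    _ ≤ (Real.exp 1 * n / t) ^ t * (((2 * n).choose r : ℕ) * ((r : ℝ) ^ 2 / (2 * n) ^ 2) ^ t) := by
        gcongr
    _ = ((Real.exp 1 * n / t) * ((r : ℝ) ^ 2 / (2 * n) ^ 2)) ^ t * ((2 * n).choose r : ℕ) := by
        rw [mul_pow]; ring
    _ = _ := by
        congr 2
        field_simp
        norm_num
end

section
/- Fix an integer n ≥ 2 and let x = (x_1, …, x_{2n}) be drawn uniformly at random from [n]^{2n}. Let U(x) denote the number of unique pairs of x. Then the expected value of U(x) is strictly greater than (n−1)/(2e²). -/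
/-- The set of unique pairs of `x ∈ [n]^{2n}`: pairs `(i, j)` with `i < j`, `x_i = x_j`, and
no other index `k` has `x_k = x_i`. -/
def uniquePairs (n : ℕ) (x : Fin (2 * n) → Fin n) : Finset (Fin (2 * n) × Fin (2 * n)) :=
  Finset.univ.filter
    (fun p => p.1 < p.2 ∧ x p.1 = x p.2 ∧ ∀ k, k ≠ p.1 → k ≠ p.2 → x k ≠ x p.1)

lemma aux_fiber (m n : ℕ) (i j : Fin m) (hij : i ≠ j) :
    (Finset.univ.filter (fun x : Fin m → Fin n =>
      x i = x j ∧ ∀ k, k ≠ i → k ≠ j → x k ≠ x i)).card = n * (n - 1) ^ (m - 2) := by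
  classical
  rw [Finset.card_eq_sum_card_fiberwise (f := fun x => x i) (t := Finset.univ)
    (fun x _ => Finset.mem_coe.2 (Finset.mem_univ _))]
  have h : ∀ v : Fin n, ((Finset.univ.filter (fun x : Fin m → Fin n =>
      x i = x j ∧ ∀ k, k ≠ i → k ≠ j → x k ≠ x i)).filter (fun x => x i = v)).card
        = (n - 1) ^ (m - 2) := by
    intro v
    have : ((Finset.univ.filter (fun x : Fin m → Fin n =>
      x i = x j ∧ ∀ k, k ≠ i → k ≠ j → x k ≠ x i)).filter (fun x => x i = v))
      = Fintype.piFinset (fun k => if k ∈ ({i, j} : Finset (Fin m)) then {v} else ({v}ᶜ : Finset (Fin n))) := by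
      ext x
      simp only [Finset.mem_filter, Finset.mem_univ, true_and, Fintype.mem_piFinset]
      constructor
      · rintro ⟨⟨h1, h2⟩, h3⟩ k
        by_cases hk : k ∈ ({i, j} : Finset (Fin m))
        · rw [if_pos hk]
          simp only [Finset.mem_insert, Finset.mem_singleton] at hk ⊢
          rcases hk with rfl | rfl
          · exact h3
          · rw [← h1, h3]
        · rw [if_neg hk]
          simp only [Finset.mem_insert, Finset.mem_singleton, not_or] at hk
          simp only [Finset.mem_compl, Finset.mem_singleton]
          rw [← h3]
          exact h2 k hk.1 hk.2
      · intro h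
        have hi : x i = v := by simpa using h i
        have hj : x j = v := by simpa using h j
        refine ⟨⟨by rw [hi, hj], ?_⟩, hi⟩
        intro k h1 h2
        have := h k
        rw [if_neg (by simp [h1, h2])] at this
        rw [hi]
        simpa using this
    rw [this, Fintype.card_piFinset]
    have h5 : ∀ k, (if k ∈ ({i, j} : Finset (Fin m)) then {v} else ({v}ᶜ : Finset (Fin n))).card
        = if k ∈ ({i, j} : Finset (Fin m)) then 1 else n - 1 := by
      intro k
      split_ifs
      · simp
      · simp [Finset.card_compl]
    rw [Finset.prod_congr rfl (fun k _ => h5 k), Finset.prod_ite]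
    simp only [Finset.prod_const, one_pow, one_mul]
    congr 1
    have : (Finset.univ.filter (fun k => k ∉ ({i, j} : Finset (Fin m)))) = ({i, j} : Finset (Fin m))ᶜ := by
      ext k; simp
    rw [this, Finset.card_compl, Finset.card_pair hij, Fintype.card_fin]
  rw [Finset.sum_congr rfl (fun v _ => h v)]
  simp

lemma aux_pairs (n : ℕ) : n * n ≤ (Finset.univ.filter
    (fun p : Fin (2 * n) × Fin (2 * n) => p.1 < p.2)).card := by
  have : (Finset.univ : Finset (Fin n × Fin n)).card = n * n := by simp
  rw [← this]
  apply Finset.card_le_card_of_injOn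
    (fun q => (⟨q.1.1, by omega⟩, ⟨n + q.2.1, by omega⟩))
  · intro q _
    simp only [Finset.coe_filter, Finset.mem_univ, true_and, Set.mem_setOf_eq, Fin.mk_lt_mk]
    omega
  · rintro ⟨a, b⟩ _ ⟨c, d⟩ _ h
    simp only [Prod.mk.injEq, Fin.mk.injEq] at h
    ext <;> simp <;> omega

lemma aux_sum (n : ℕ) : n * n * (n * (n - 1) ^ (2 * n - 2)) ≤
    ∑ x : Fin (2 * n) → Fin n, (uniquePairs n x).card := by
  classical
  have h1 : ∑ x : Fin (2 * n) → Fin n, (uniquePairs n x).card =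
      ∑ p : Fin (2 * n) × Fin (2 * n), (Finset.univ.filter (fun x : Fin (2 * n) → Fin n =>
        p.1 < p.2 ∧ x p.1 = x p.2 ∧ ∀ k, k ≠ p.1 → k ≠ p.2 → x k ≠ x p.1)).card := by
    simp only [uniquePairs, Finset.card_filter]
    exact Finset.sum_comm
  rw [h1]
  calc _ ≤ (Finset.univ.filter
        (fun p : Fin (2 * n) × Fin (2 * n) => p.1 < p.2)).card * (n * (n - 1) ^ (2 * n - 2)) :=
        Nat.mul_le_mul_right _ (aux_pairs n)
    _ = ∑ p ∈ Finset.univ.filter (fun p : Fin (2 * n) × Fin (2 * n) => p.1 < p.2),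
        (Finset.univ.filter (fun x : Fin (2 * n) → Fin n =>
        p.1 < p.2 ∧ x p.1 = x p.2 ∧ ∀ k, k ≠ p.1 → k ≠ p.2 → x k ≠ x p.1)).card := by
        rw [← smul_eq_mul, ← Finset.sum_const]
        apply Finset.sum_congr rfl
        intro p hp
        have hp' := (Finset.mem_filter.1 hp).2
        rw [← aux_fiber (2 * n) n p.1 p.2 hp'.ne]
        simp only [hp', true_and]
    _ ≤ _ := Finset.sum_le_sum_of_subset (Finset.filter_subset _ _)

lemma aux_exp (m : ℕ) (hm : 1 ≤ m) : ((m : ℝ) + 1) ^ m ≤ (m : ℝ) ^ m * Real.exp 1 := by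
  have hm' : (0 : ℝ) < m := by exact_mod_cast hm
  have h : (m : ℝ) + 1 ≤ m * Real.exp (1 / m) := by
    have := Real.add_one_le_exp (1 / (m : ℝ))
    calc (m : ℝ) + 1 = m * (1 / m + 1) := by field_simp; ring
      _ ≤ _ := by gcongr
  calc ((m : ℝ) + 1) ^ m ≤ (m * Real.exp (1 / m)) ^ m := by gcongr
    _ = _ := by
      rw [mul_pow, ← Real.exp_nat_mul]
      congr 2
      field_simp

/-- For `n ≥ 2` and `x` drawn uniformly from `[n]^{2n}`, the expected number of unique pairs
of `x` is strictly greater than `(n−1)/(2e²)`. -/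
theorem stmt_9 (n : ℕ) (hn : 2 ≤ n) :
    ((n : ℝ) - 1) / (2 * Real.exp 1 ^ 2) <
      (∑ x : Fin (2 * n) → Fin n, ((uniquePairs n x).card : ℝ)) /
        (((Finset.univ : Finset (Fin (2 * n) → Fin n)).card : ℝ)) := by
  have hs := aux_sum n
  have hs' : (n : ℝ) * n * (n * ((n - 1 : ℕ) : ℝ) ^ (2 * n - 2)) ≤
      ∑ x : Fin (2 * n) → Fin n, ((uniquePairs n x).card : ℝ) := by exact_mod_cast hs
  have hc : ((Finset.univ : Finset (Fin (2 * n) → Fin n)).card : ℝ) = (n : ℝ) ^ (2 * n) := by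
    simp
  rw [hc]
  obtain ⟨m, rfl⟩ : ∃ m, n = m + 1 := ⟨n - 1, by omega⟩
  have hm : 1 ≤ m := by omega
  have hm' : (0 : ℝ) < m := by exact_mod_cast hm
  have he := aux_exp m hm
  have e1 : 2 * (m + 1) - 2 = m * 2 := by omega
  have e2 : 2 * (m + 1) = m * 2 + 2 := by omega
  rw [e1, Nat.add_sub_cancel] at hs'
  rw [div_lt_div_iff₀ (by positivity) (by positivity)]
  have hE := Real.exp_pos 1
  have hsq : (((m : ℝ) + 1) ^ m) ^ 2 ≤ ((m : ℝ) ^ m * Real.exp 1) ^ 2 := by gcongr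
  push_cast at hs' ⊢
  have e3 : ((m : ℝ) + 1) ^ (2 * (m + 1)) = (((m : ℝ) + 1) ^ m) ^ 2 * (m + 1) ^ 2 := by
    rw [e2, pow_add, pow_mul]
  rw [e3]
  rw [pow_mul] at hs'
  have hA : 0 < ((m : ℝ) ^ m * Real.exp 1) ^ 2 := by positivity
  calc ((m : ℝ) + 1 - 1) * ((((m : ℝ) + 1) ^ m) ^ 2 * (m + 1) ^ 2)
      ≤ m * (((m : ℝ) ^ m * Real.exp 1) ^ 2 * (m + 1) ^ 2) := by
        rw [add_sub_cancel_right]; gcongr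
    _ < (2 * (m + 1)) * (((m : ℝ) ^ m * Real.exp 1) ^ 2 * (m + 1) ^ 2) := by
        gcongr
        linarith
    _ = (((m : ℝ) + 1) * (m + 1) * ((m + 1) * ((m : ℝ) ^ m) ^ 2)) * (2 * Real.exp 1 ^ 2) := by ring
    _ ≤ _ := by gcongr
end
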